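/- Let α ∈ (0,1) and let g : (0,∞) → ℝ be such that g and y ↦ y·g(y) belong to L¹(0,∞) and g has compact support. Then the maps g ↦ v^±(·,t) − m·𝔈_t(·) are of weak type (1,1): for all t > 1 and every σ > 0, σ·|{ x > 0 : |v^+(x,t) − m·𝔈_t(x)| > σ }| ≤ C_2(α)·t^{−1/(1+α)}·‖y g(y)‖_{L¹(0,∞)}, and the same bound holds with v^− in place of v^+, where |·| denotes one-dimensional Lebesgue measure and C_2(α) = 2 a_0 C_1(α). -/

import Mathlib

open Real MeasureTheory Set Filter Topology

noncomputable def bCoef (α : ℝ) (n : ℕ) : ℝ :=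
  ∏ i ∈ Finset.range n, Real.Gamma (α * i + i + 2) / Real.Gamma (α * (i + 1) + i + 2)

/-- The profile function `Φ(x) = ∑ bₙ (−x^{1+α}/(1+α))ⁿ`. -/
noncomputable def Phi (α : ℝ) (x : ℝ) : ℝ :=
  ∑' n : ℕ, bCoef α n * (-(x ^ (1 + α)) / (1 + α)) ^ n

/-- The Caputo fractional derivative of order `α`. -/
noncomputable def caputo (α : ℝ) (f : ℝ → ℝ) (x : ℝ) : ℝ :=
  (1 / Real.Gamma (1 - α)) * ∫ τ in (0:ℝ)..x, deriv f τ * (x - τ) ^ (-α)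

/-- The normalizing constant `a₀` with `1/a₀ = 2∫₀^∞ Φ`. -/
noncomputable def a0 (α : ℝ) : ℝ := (2 * ∫ x in Set.Ioi (0:ℝ), Phi α x)⁻¹

/-- The fundamental solution `𝔈_t(x) = a₀ t^{−1/(1+α)} Φ(|x| t^{−1/(1+α)})`. -/
noncomputable def fundSol (α t x : ℝ) : ℝ :=
  a0 α * t ^ (-1/(1+α)) * Phi α (|x| * t ^ (-1/(1+α)))

noncomputable def C1 (α : ℝ) : ℝ :=
  α * (2:ℝ) ^ (1+α) * max (∫ u in (1/2:ℝ)..1, u ^ (-(1+α)) * (1-u) ^ (α-1)) 2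

noncomputable def C2 (α : ℝ) : ℝ := 2 * a0 α * C1 α

/-- Absolute convergence of the power series everywhere. -/
def SA (c : ℕ → ℝ) : Prop := ∀ r : ℝ, Summable fun n : ℕ => |c n * r ^ n|

noncomputable def PS (c : ℕ → ℝ) (z : ℝ) : ℝ := ∑' n : ℕ, c n * z ^ n

lemma SA.summable {c : ℕ → ℝ} (h : SA c) (z : ℝ) : Summable fun n : ℕ => c n * z ^ n :=
  (h z).of_abs

lemma SA.nmul {c : ℕ → ℝ} (h : SA c) : SA (fun n => n * c n) := by
  intro r
  refine Summable.of_nonneg_of_le (fun n => abs_nonneg _) (fun n => ?_) (h (2 * r))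
  have h2 : (n : ℝ) ≤ 2 ^ n := by exact_mod_cast (Nat.lt_two_pow_self).le
  rw [mul_pow, abs_mul, abs_mul, abs_mul, abs_mul, abs_of_nonneg (Nat.cast_nonneg n : (0:ℝ) ≤ n),
    abs_of_nonneg (by positivity : (0:ℝ) ≤ 2 ^ n)]
  have : 0 ≤ |c n| * |r ^ n| := by positivity
  nlinarith

lemma SA.cmul {c : ℕ → ℝ} (h : SA c) (a : ℝ) : SA (fun n => a * c n) := by
  intro r
  refine ((h r).mul_left |a|).congr (fun n => ?_)
  rw [mul_assoc, abs_mul a]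

lemma SA.add {c d : ℕ → ℝ} (h : SA c) (h' : SA d) : SA (fun n => c n + d n) := by
  intro r
  refine Summable.of_nonneg_of_le (fun n => abs_nonneg _) (fun n => ?_) ((h r).add (h' r))
  rw [add_mul]; exact abs_add_le _ _

lemma SA.lin {c : ℕ → ℝ} (h : SA c) (a b : ℝ) : SA (fun n => (a * n + b) * c n) := by
  have := (h.nmul.cmul a).add (h.cmul b)
  convert this using 2
  ring

lemma SA.shift {c : ℕ → ℝ} (h : SA c) : SA (fun n => c (n + 1)) := by
  intro r
  have := (summable_nat_add_iff 1).2 (h (|r| + 1))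
  refine Summable.of_nonneg_of_le (fun n => abs_nonneg _) (fun n => ?_) this
  rw [abs_mul, abs_mul, abs_pow, abs_pow, abs_of_nonneg (by positivity : (0:ℝ) ≤ |r| + 1)]
  gcongr
  calc |r| ^ n ≤ (|r| + 1) ^ n := by gcongr; linarith
    _ ≤ (|r| + 1) ^ (n + 1) := by
      apply pow_le_pow_right₀ _ (Nat.le_succ n); linarith [abs_nonneg r]

lemma PS_hasDerivAt {c : ℕ → ℝ} (h : SA c) (z : ℝ) :
    HasDerivAt (PS c) (∑' n : ℕ, c n * (n * z ^ (n - 1))) z := by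
  set R : ℝ := |z| + 1 with hR
  have hR1 : 1 ≤ R := by have := abs_nonneg z; linarith
  have hu : Summable fun n : ℕ => |(fun n : ℕ => (n:ℝ) * c n) n * R ^ n| := h.nmul R
  refine hasDerivAt_tsum_of_isPreconnected (t := Metric.ball 0 R) (y₀ := 0)
    (g := fun n w => c n * w ^ n) (g' := fun n w => c n * (n * w ^ (n - 1))) hu
    Metric.isOpen_ball (convex_ball 0 R).isPreconnected ?_ ?_ ?_ ?_ ?_
  · intro n y _
    exact (hasDerivAt_pow n y).const_mul _
  · intro n y hy
    have hy' : |y| ≤ R := by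
      have := Metric.mem_ball.1 hy; rw [Real.dist_eq, sub_zero] at this; exact this.le
    rw [Real.norm_eq_abs, abs_mul, abs_mul, abs_mul, abs_mul, abs_pow, abs_pow,
      abs_of_nonneg (by linarith : 0 ≤ R), ← mul_assoc, mul_comm |c n|]
    gcongr
    calc |y| ^ (n-1) ≤ R ^ (n-1) := by gcongr
      _ ≤ R ^ n := pow_le_pow_right₀ hR1 (Nat.sub_le n 1)
  · simp; linarith
  · exact h.summable 0
  · simp [hR]

lemma PS_cont {c : ℕ → ℝ} (h : SA c) : Continuous (PS c) :=
  continuous_iff_continuousAt.2 fun z => (PS_hasDerivAt h z).continuousAt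

lemma PS_deriv_mul (c : ℕ → ℝ) (z : ℝ) :
    z * (∑' n : ℕ, c n * (n * z ^ (n - 1))) = PS (fun n => n * c n) z := by
  rw [PS, ← tsum_mul_left]
  congr 1; ext n
  cases n with
  | zero => simp
  | succ n => simp only [Nat.add_sub_cancel]; ring

lemma PS_lin {c : ℕ → ℝ} (h : SA c) (a b z : ℝ) :
    PS (fun n => (a * n + b) * c n) z = a * PS (fun n => n * c n) z + b * PS c z := by
  rw [PS, PS, PS, ← tsum_mul_left, ← tsum_mul_left,
    ← ((h.nmul.summable z).mul_left a).tsum_add ((h.summable z).mul_left b)]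
  congr 1; ext n; ring

noncomputable def SS (p s : ℝ) (c : ℕ → ℝ) (x : ℝ) : ℝ := x ^ s * PS c (x ^ p)

lemma SS_hasDerivAt {c : ℕ → ℝ} (h : SA c) (p s : ℝ) {x : ℝ} (hx : 0 < x) :
    HasDerivAt (SS p s c) (SS p (s - 1) (fun n => (p * n + s) * c n) x) x := by
  have h1 : HasDerivAt (fun x : ℝ => x ^ s) (s * x ^ (s - 1)) x :=
    Real.hasDerivAt_rpow_const (Or.inl hx.ne')
  have h2 : HasDerivAt (fun x : ℝ => x ^ p) (p * x ^ (p - 1)) x :=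
    Real.hasDerivAt_rpow_const (Or.inl hx.ne')
  have h3 := h1.mul ((PS_hasDerivAt h (x ^ p)).comp x h2)
  refine h3.congr_deriv ?_
  simp only [SS, PS_lin h, ← PS_deriv_mul, Function.comp]
  have e1 : x ^ s = x ^ (s - 1) * x := by rw [← Real.rpow_add_one hx.ne']; ring_nf
  have e2 : x ^ p = x ^ (p - 1) * x := by rw [← Real.rpow_add_one hx.ne']; ring_nf
  generalize (∑' n : ℕ, c n * (n * (x ^ p) ^ (n - 1))) = D
  rw [e1]
  generalize PS c (x ^ p) = Q
  rw [e2]; ring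

lemma betaR {s r x : ℝ} (hs : 0 < s) (hr : 0 < r) (hx : 0 < x) :
    ∫ τ in (0:ℝ)..x, τ ^ (s - 1) * (x - τ) ^ (r - 1)
      = x ^ (s + r - 1) * (Real.Gamma s * Real.Gamma r / Real.Gamma (s + r)) := by
  have h := Complex.betaIntegral_scaled (s : ℂ) (r : ℂ) hx
  rw [Complex.betaIntegral_eq_Gamma_mul_div _ _ (by simpa) (by simpa)] at h
  have e : ∫ τ in (0:ℝ)..x, (τ : ℂ) ^ ((s:ℂ) - 1) * ((x : ℂ) - τ) ^ ((r:ℂ) - 1)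
      = ∫ τ in (0:ℝ)..x, ((τ ^ (s - 1) * (x - τ) ^ (r - 1) : ℝ) : ℂ) := by
    apply intervalIntegral.integral_congr
    intro τ hτ
    rw [uIcc_of_le hx.le] at hτ
    simp only
    rw [Complex.ofReal_mul, Complex.ofReal_cpow hτ.1, Complex.ofReal_cpow (by linarith [hτ.2])]
    push_cast; rfl
  rw [e, intervalIntegral.integral_ofReal] at h
  rw [← Complex.ofReal_add, Complex.Gamma_ofReal, Complex.Gamma_ofReal, Complex.Gamma_ofReal,
    ← Complex.ofReal_one, ← Complex.ofReal_sub, ← Complex.ofReal_cpow hx.le] at h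
  exact_mod_cast h

lemma betaR_int {s r x : ℝ} (hs : 0 < s) (hr : 0 < r) (hx : 0 < x) :
    IntervalIntegrable (fun τ : ℝ => τ ^ (s - 1) * (x - τ) ^ (r - 1)) volume 0 x := by
  apply intervalIntegral.intervalIntegrable_of_integral_ne_zero
  rw [betaR hs hr hx]
  have := Real.Gamma_pos_of_pos hs
  have := Real.Gamma_pos_of_pos hr
  have := Real.Gamma_pos_of_pos (add_pos hs hr)
  positivity

lemma SS_int {c : ℕ → ℝ} (h : SA c) {p s α x : ℝ} (hp : 0 < p) (hs : 0 < s) (hα : α < 1)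
    (hx : 0 < x) :
    IntervalIntegrable (fun τ : ℝ => SS p (s - 1) c τ * (x - τ) ^ (-α)) volume 0 x := by
  have h1 := betaR_int hs (by linarith : 0 < 1 - α) hx
  have h2 : ContinuousOn (fun τ : ℝ => PS c (τ ^ p)) (uIcc 0 x) :=
    ((PS_cont h).comp (Real.continuous_rpow_const hp.le)).continuousOn
  refine (h1.mul_continuousOn h2).congr ?_
  intro τ _
  simp only [SS]
  rw [show 1 - α - 1 = -α by ring]; ring

lemma SS_caputo {c : ℕ → ℝ} (h : SA c) {p s α x : ℝ} (hp : 0 < p) (hs : 0 < s) (hα : α < 1)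
    (hx : 0 < x) :
    ∫ τ in (0:ℝ)..x, SS p (s - 1) c τ * (x - τ) ^ (-α)
      = x ^ (s - α) * PS (fun n => c n *
        (Real.Gamma (p * n + s) * Real.Gamma (1 - α) / Real.Gamma (p * n + s + (1 - α)))) (x ^ p) := by
  have hr : 0 < 1 - α := by linarith
  have h1 := betaR_int hs hr hx
  have key := intervalIntegral.hasSum_integral_of_dominated_convergence (μ := volume)
    (a := 0) (b := x)
    (F := fun (n : ℕ) τ => c n * (τ ^ (p * n + s - 1) * (x - τ) ^ (1 - α - 1)))
    (f := fun τ => SS p (s - 1) c τ * (x - τ) ^ (-α))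
    (fun (n : ℕ) τ => |c n * (x ^ p) ^ n| * (τ ^ (s - 1) * (x - τ) ^ (1 - α - 1)))
    ?_ ?_ ?_ ?_ ?_
  · rw [← key.tsum_eq, PS, ← tsum_mul_left]
    congr 1; ext n
    rw [intervalIntegral.integral_const_mul, betaR (by positivity) hr hx]
    rw [← Real.rpow_natCast (x ^ p), ← Real.rpow_mul hx.le,
      show p * n + s + (1 - α) - 1 = (s - α) + p * n by ring, Real.rpow_add hx]
    ring
  · intro n
    have := (betaR_int (by positivity : 0 < p * n + s) hr hx).const_mul (c n)
    rw [uIoc_of_le hx.le]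
    exact this.1.aestronglyMeasurable
  · intro n
    refine Eventually.of_forall fun τ hτ => ?_
    rw [uIoc_of_le hx.le] at hτ
    have hτ0 : 0 < τ := hτ.1
    have hb : 0 ≤ (x - τ) ^ (1 - α - 1) := Real.rpow_nonneg (by linarith [hτ.2]) _
    rw [Real.norm_eq_abs, abs_mul, abs_mul, abs_mul, abs_of_nonneg hb, mul_assoc]
    refine mul_le_mul_of_nonneg_left ?_ (abs_nonneg _)
    rw [← mul_assoc]
    refine mul_le_mul_of_nonneg_right ?_ hb
    rw [abs_of_nonneg (by positivity), abs_of_nonneg (by positivity),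
      show p * n + s - 1 = p * n + (s - 1) by ring, Real.rpow_add hτ0, Real.rpow_mul hτ0.le,
      Real.rpow_natCast]
    have := hτ.2
    gcongr
  · exact Eventually.of_forall fun τ _ => (h (x ^ p)).mul_right _
  · simp_rw [tsum_mul_right]
    exact h1.const_mul _
  · refine Eventually.of_forall fun τ hτ => ?_
    rw [uIoc_of_le hx.le] at hτ
    have hτ0 : 0 < τ := hτ.1
    have := ((h.summable (τ ^ p)).hasSum.mul_left (τ ^ (s - 1))).mul_right ((x - τ) ^ (-α))
    have e2 : (fun n : ℕ => c n * (τ ^ (p * n + s - 1) * (x - τ) ^ (1 - α - 1)))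
        = fun n : ℕ => τ ^ (s - 1) * (c n * (τ ^ p) ^ n) * (x - τ) ^ (-α) := by
      funext n
      rw [show p * n + s - 1 = p * n + (s - 1) by ring, Real.rpow_add hτ0, Real.rpow_mul hτ0.le,
        Real.rpow_natCast, show 1 - α - 1 = -α by ring]
      ring
    rw [e2]
    exact this

noncomputable def cC (α : ℝ) (n : ℕ) : ℝ := bCoef α n * (-1 / (1 + α)) ^ n

lemma cC_zero (α : ℝ) : cC α 0 = 1 := by simp [cC, bCoef]

lemma cC_succ (α : ℝ) (n : ℕ) : cC α (n + 1) = cC α n * (-1 / (1 + α)) *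
    (Real.Gamma ((1 + α) * n + 2) / Real.Gamma ((1 + α) * n + 2 + α)) := by
  rw [cC, cC, bCoef, bCoef, Finset.prod_range_succ, pow_succ,
    show α * n + n + 2 = (1 + α) * n + 2 by ring,
    show α * ((n:ℝ) + 1) + n + 2 = (1 + α) * n + 2 + α by ring]
  ring

lemma Gamma_ratio {α y : ℝ} (h0 : 0 < α) (h1 : α < 1) (hy : 1 ≤ y) :
    Real.Gamma y / Real.Gamma (y + α) ≤ 2 * (y + α) ^ (-α) := by
  have hp : 0 < y + α := by linarith
  have hG := Real.Gamma_pos_of_pos hp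
  have h := Real.Gamma_mul_add_mul_le_rpow_Gamma_mul_rpow_Gamma hp (by linarith : 0 < y + α + 1)
    h0 (by linarith : 0 < 1 - α) (by ring)
  rw [show α * (y + α) + (1 - α) * (y + α + 1) = y + 1 by ring, Real.Gamma_add_one hp.ne',
    Real.Gamma_add_one (by linarith : y ≠ 0), Real.mul_rpow hp.le hG.le] at h
  have e : Real.Gamma (y + α) ^ α * ((y + α) ^ (1 - α) * Real.Gamma (y + α) ^ (1 - α))
      = (y + α) ^ (1 - α) * Real.Gamma (y + α) := by
    have : Real.Gamma (y + α) ^ α * Real.Gamma (y + α) ^ (1 - α) = Real.Gamma (y + α) := by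
      rw [← Real.rpow_add hG]; simp
    calc _ = (y + α) ^ (1 - α) * (Real.Gamma (y + α) ^ α * Real.Gamma (y + α) ^ (1 - α)) := by ring
      _ = _ := by rw [this]
  rw [e, show 1 - α = 1 + -α by ring, Real.rpow_add hp, Real.rpow_one] at h
  rw [div_le_iff₀ hG]
  have hq : 0 < (y + α) ^ (-α) * Real.Gamma (y + α) := by positivity
  have : y * Real.Gamma y ≤ y * (2 * ((y + α) ^ (-α) * Real.Gamma (y + α))) := by
    nlinarith
  have := le_of_mul_le_mul_left this (by linarith)
  linarith

lemma cC_SA {α : ℝ} (h0 : 0 < α) (h1 : α < 1) : SA (cC α) := by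
  intro r
  set K : ℝ := |-1 / (1 + α)| * |r| with hK
  have ht : Tendsto (fun n : ℕ => K * (2 * ((1 + α) * (n:ℝ) + 2 + α) ^ (-α))) atTop (𝓝 0) := by
    have ha : Tendsto (fun n : ℕ => (1 + α) * (n:ℝ) + 2 + α) atTop atTop := by
      apply tendsto_atTop_add_const_right
      apply tendsto_atTop_add_const_right
      exact tendsto_natCast_atTop_atTop.const_mul_atTop (by linarith)
    have := (((tendsto_rpow_neg_atTop h0).comp ha).const_mul 2).const_mul K
    simpa using this
  refine summable_of_ratio_norm_eventually_le (r := 1 / 2) (by norm_num) ?_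
  filter_upwards [ht.eventually (gt_mem_nhds (by norm_num : (0:ℝ) < 1 / 2))] with n hn
  rw [cC_succ, Real.norm_eq_abs, Real.norm_eq_abs, abs_abs, abs_abs, pow_succ]
  have hy : 1 ≤ (1 + α) * (n:ℝ) + 2 := by
    have : 0 ≤ (1 + α) * (n:ℝ) := by positivity
    linarith
  have hg := Gamma_ratio h0 h1 hy
  have hpos : 0 ≤ Real.Gamma ((1 + α) * n + 2) / Real.Gamma ((1 + α) * n + 2 + α) :=
    div_nonneg (Real.Gamma_pos_of_pos (by linarith)).le (Real.Gamma_pos_of_pos (by linarith)).le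
  set G := Real.Gamma ((1 + α) * n + 2) / Real.Gamma ((1 + α) * n + 2 + α) with hGdef
  have e : |cC α n * (-1 / (1 + α)) * G * (r ^ n * r)| = (K * G) * |cC α n * r ^ n| := by
    simp only [abs_mul, abs_of_nonneg hpos, hK]; ring
  rw [e]
  gcongr
  have : K * G ≤ K * (2 * ((1 + α) * (n:ℝ) + 2 + α) ^ (-α)) := by gcongr
  linarith

lemma Phi_eq (α x : ℝ) : Phi α x = PS (cC α) (x ^ (1 + α)) := by
  rw [Phi, PS]; congr 1; ext n
  rw [cC, mul_assoc, ← mul_pow]; congr 2; ring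

/-- coefficients of `Φ'`. -/
noncomputable def dC (α : ℝ) (n : ℕ) : ℝ := ((1 + α) * n + (1 + α)) * cC α (n + 1)

lemma dC_SA {α : ℝ} (h0 : 0 < α) (h1 : α < 1) : SA (dC α) := (cC_SA h0 h1).shift.lin _ _

lemma Phi_eq' {α x : ℝ} (h0 : 0 < α) (h1 : α < 1) :
    Phi α x = 1 + SS (1 + α) (1 + α) (fun n => cC α (n + 1)) x := by
  rw [Phi_eq, SS, PS, PS, ((cC_SA h0 h1).summable _).tsum_eq_zero_add, ← tsum_mul_left, cC_zero]
  simp only [pow_zero, mul_one]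
  congr 2; ext n; ring

lemma Phi_deriv {α x : ℝ} (h0 : 0 < α) (h1 : α < 1) (hx : 0 < x) :
    HasDerivAt (Phi α) (SS (1 + α) α (dC α) x) x := by
  have := (SS_hasDerivAt (cC_SA h0 h1).shift (1 + α) (1 + α) hx).const_add 1
  rw [show 1 + α - 1 = α by ring] at this
  rw [show Phi α = fun x => 1 + SS (1 + α) (1 + α) (fun n => cC α (n + 1)) x from
    funext fun x => Phi_eq' h0 h1]
  exact this

lemma Phi_cont {α : ℝ} (h0 : 0 < α) (h1 : α < 1) : Continuous (Phi α) := by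
  rw [show Phi α = fun x => PS (cC α) (x ^ (1 + α)) from funext fun x => Phi_eq α x]
  exact (PS_cont (cC_SA h0 h1)).comp (Real.continuous_rpow_const (by linarith))

lemma Phi_zero {α : ℝ} (h0 : 0 < α) (h1 : α < 1) : Phi α 0 = 1 := by
  rw [Phi_eq' h0 h1, SS, Real.zero_rpow (by linarith)]; simp

/-- Caputo equation for `Φ`. -/
lemma caputo1 {α x : ℝ} (h0 : 0 < α) (h1 : α < 1) (hx : 0 < x) :
    ∫ τ in (0:ℝ)..x, SS (1 + α) α (dC α) τ * (x - τ) ^ (-α)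
      = - (Real.Gamma (1 - α) / (1 + α)) * x * Phi α x := by
  have h := SS_caputo (dC_SA h0 h1) (by linarith : 0 < 1 + α) (by linarith : 0 < 1 + α) h1 hx
  rw [show 1 + α - 1 = α by ring, show 1 + α - α = 1 by ring, Real.rpow_one] at h
  have e0 : - (Real.Gamma (1 - α) / (1 + α)) * x * Phi α x
      = x * (- (Real.Gamma (1 - α) / (1 + α)) * Phi α x) := by ring
  rw [h, e0, Phi_eq]
  congr 1
  rw [PS, PS, ← tsum_mul_left]
  refine tsum_congr fun n => ?_
  have hy : 0 < (1 + α) * (n:ℝ) + (1 + α) := by positivity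
  have e := Real.Gamma_add_one hy.ne'
  rw [show (1 + α) * (n:ℝ) + (1 + α) + 1 = (1 + α) * n + 2 + α by ring] at e
  rw [dC, cC_succ, show (1 + α) * (n:ℝ) + (1 + α) + (1 - α) = (1 + α) * n + 2 by ring, e]
  have g1 := (Real.Gamma_pos_of_pos (by positivity : 0 < (1 + α) * (n:ℝ) + 2)).ne'
  have g2 := (Real.Gamma_pos_of_pos hy).ne'
  field_simp

/-- Caputo equation for `Φ'`. -/
lemma caputo2 {α x : ℝ} (h0 : 0 < α) (h1 : α < 1) (hx : 0 < x) :
    ∫ τ in (0:ℝ)..x, SS (1 + α) (α - 1) (fun n => ((1 + α) * n + α) * dC α n) τ * (x - τ) ^ (-α)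
      = - (Real.Gamma (1 - α) / (1 + α)) * (Phi α x + x * SS (1 + α) α (dC α) x) := by
  have h := SS_caputo ((dC_SA h0 h1).lin (1 + α) α) (by linarith : 0 < 1 + α) h0 h1 hx
  rw [sub_self, Real.rpow_zero, one_mul] at h
  have e1 : Phi α x + x * SS (1 + α) α (dC α) x
      = PS (fun n => ((1 + α) * n + 1) * cC α n) (x ^ (1 + α)) := by
    rw [PS_lin (cC_SA h0 h1), Phi_eq, SS]
    have : x * (x ^ α * PS (dC α) (x ^ (1 + α)))
        = (1 + α) * PS (fun n => n * cC α n) (x ^ (1 + α)) := by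
      rw [← mul_assoc, mul_comm x, ← Real.rpow_add_one hx.ne', add_comm α 1]
      generalize x ^ (1 + α) = z
      rw [PS, PS, ((cC_SA h0 h1).nmul.summable _).tsum_eq_zero_add, ← tsum_mul_left]
      simp only [Nat.cast_zero, zero_mul, zero_add]
      rw [← tsum_mul_left]
      congr 1; ext n; rw [dC]; push_cast; ring
    rw [this]; ring
  rw [h, e1, PS, PS, ← tsum_mul_left]
  congr 1; ext n
  have hy : 0 < (1 + α) * (n:ℝ) + (1 + α) := by positivity
  have hy' : 0 < (1 + α) * (n:ℝ) + α := by positivity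
  have hy'' : 0 < (1 + α) * (n:ℝ) + 1 := by positivity
  have e := Real.Gamma_add_one hy.ne'
  have e' := Real.Gamma_add_one hy'.ne'
  have e'' := Real.Gamma_add_one hy''.ne'
  rw [show (1 + α) * (n:ℝ) + (1 + α) + 1 = (1 + α) * n + 2 + α by ring] at e
  rw [show (1 + α) * (n:ℝ) + α + 1 = (1 + α) * n + (1 + α) by ring] at e'
  rw [show (1 + α) * (n:ℝ) + 1 + 1 = (1 + α) * n + 2 by ring] at e''
  rw [dC, cC_succ, show (1 + α) * (n:ℝ) + α + (1 - α) = (1 + α) * n + 1 by ring, e, e', e'']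
  have g1 := (Real.Gamma_pos_of_pos hy').ne'
  have g2 := (Real.Gamma_pos_of_pos hy'').ne'
  field_simp

/-- Maximum principle for the Caputo derivative. -/
lemma maxprinc {α X : ℝ} (h0 : 0 < α) (h1 : α < 1) (hX : 0 < X) {u u' : ℝ → ℝ}
    (hc : ContinuousOn u (Icc 0 X)) (hd : ∀ x, 0 < x → HasDerivAt u (u' x) x)
    (hu0 : u 0 = 0) (huX : u X = 0) (hpos : ∀ x ∈ Icc 0 X, 0 ≤ u x)
    (hi : IntervalIntegrable (fun τ => u' τ * (X - τ) ^ (-α)) volume 0 X) :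
    ∫ τ in (0:ℝ)..X, u' τ * (X - τ) ^ (-α) ≤ 0 := by
  have hlim1 : Tendsto (fun y => ∫ τ in (0:ℝ)..y, u' τ * (X - τ) ^ (-α)) (𝓝[<] X)
      (𝓝 (∫ τ in (0:ℝ)..X, u' τ * (X - τ) ^ (-α))) := by
    have hc := intervalIntegral.continuousOn_primitive_interval'
      hi (left_mem_uIcc)
    have := hc X right_mem_uIcc
    refine this.mono_left (nhdsWithin_le_iff.2 ?_)
    rw [uIcc_of_le hX.le]
    exact mem_of_superset (Ioo_mem_nhdsLT hX) Ioo_subset_Icc_self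
  have hlim2 : Tendsto (fun y => u y * (X - y) ^ (-α)) (𝓝[<] X) (𝓝 0) := by
    have hs : Tendsto (slope u X) (𝓝[<] X) (𝓝 (u' X)) :=
      ((hasDerivAt_iff_tendsto_slope.1 (hd X hX))).mono_left
        (nhdsWithin_mono _ fun y hy => ne_of_lt hy)
    have hr : Tendsto (fun y : ℝ => (X - y) ^ (1 - α)) (𝓝[<] X) (𝓝 0) := by
      have : Continuous fun y : ℝ => (X - y) ^ (1 - α) :=
        (Real.continuous_rpow_const (by linarith)).comp (by fun_prop)
      have h := this.tendsto X
      rw [sub_self, Real.zero_rpow (by linarith)] at h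
      exact h.mono_left nhdsWithin_le_nhds
    have := (hs.mul hr).neg
    rw [mul_zero, neg_zero] at this
    refine this.congr' ?_
    filter_upwards [self_mem_nhdsWithin] with y hy
    have hy' : 0 < X - y := sub_pos.2 hy
    rw [slope_def_field, huX, show 1 - α = 1 + -α by ring, Real.rpow_add hy', Real.rpow_one]
    have : y - X ≠ 0 := by linarith
    field_simp
    ring
  refine le_of_tendsto_of_tendsto hlim1 hlim2 ?_
  filter_upwards [Ioo_mem_nhdsLT hX] with y hy
  have hsub : uIcc 0 y ⊆ uIcc 0 X := by
    rw [uIcc_of_le hy.1.le, uIcc_of_le hX.le]; exact Icc_subset_Icc_right hy.2.le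
  have hXt : ∀ τ ∈ Icc 0 y, 0 < X - τ := fun τ hτ => by linarith [hτ.2, hy.2]
  have hcu : ContinuousOn u (Icc 0 y) := hc.mono (Icc_subset_Icc_right hy.2.le)
  have hck : ∀ b : ℝ, ContinuousOn (fun τ : ℝ => (X - τ) ^ b) (Icc 0 y) := fun b =>
    (continuousOn_const.sub continuousOn_id).rpow_const fun τ hτ => Or.inl (hXt τ hτ).ne'
  have hi1 : IntervalIntegrable (fun τ => u' τ * (X - τ) ^ (-α)) volume 0 y := hi.mono_set hsub
  have hi2 : IntervalIntegrable (fun τ => u τ * (α * (X - τ) ^ (-α - 1))) volume 0 y := by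
    apply ContinuousOn.intervalIntegrable
    rw [uIcc_of_le hy.1.le]
    exact hcu.mul (continuousOn_const.mul (hck _))
  have ftc := intervalIntegral.integral_eq_sub_of_hasDerivAt_of_le
    (f := fun τ => u τ * (X - τ) ^ (-α))
    (f' := fun τ => u' τ * (X - τ) ^ (-α) + u τ * (α * (X - τ) ^ (-α - 1))) hy.1.le
    (hcu.mul (hck _)) ?_ (hi1.add hi2)
  · rw [intervalIntegral.integral_add hi1 hi2, hu0, zero_mul, sub_zero] at ftc
    have : 0 ≤ ∫ τ in (0:ℝ)..y, u τ * (α * (X - τ) ^ (-α - 1)) := by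
      apply intervalIntegral.integral_nonneg hy.1.le
      intro τ hτ
      have a1 := hpos τ ⟨hτ.1, by linarith [hτ.2, hy.2]⟩
      have a2 := hXt τ hτ
      positivity
    linarith
  · intro τ hτ
    have hp := hXt τ (Ioo_subset_Icc_self hτ)
    have hk : HasDerivAt (fun τ : ℝ => (X - τ) ^ (-α)) (α * (X - τ) ^ (-α - 1)) τ := by
      have := ((hasDerivAt_id τ).const_sub X).rpow_const (p := -α) (Or.inl hp.ne')
      refine this.congr_deriv ?_
      simp
    exact (hd τ hτ.1).mul hk

/-- `Φ' < 0` on `(0,∞)`. -/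
lemma Phi_deriv_neg {α : ℝ} (h0 : 0 < α) (h1 : α < 1) {x : ℝ} (hx : 0 < x) :
    SS (1 + α) α (dC α) x < 0 := by
  set v : ℝ → ℝ := SS (1 + α) α (dC α) with hv
  have hG : 0 < Real.Gamma (1 - α) := Real.Gamma_pos_of_pos (by linarith)
  have hp : 0 < 1 + α := by linarith
  have hQc : Continuous fun x : ℝ => PS (dC α) (x ^ (1 + α)) :=
    (PS_cont (dC_SA h0 h1)).comp (Real.continuous_rpow_const hp.le)
  have hvc : Continuous v := (Real.continuous_rpow_const h0.le).mul hQc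
  have hv0 : v 0 = 0 := by simp [hv, SS, Real.zero_rpow h0.ne']
  have hQ0 : PS (dC α) ((0:ℝ) ^ (1 + α)) < 0 := by
    rw [Real.zero_rpow hp.ne', PS, tsum_eq_single 0 (by intro n hn; simp [hn])]
    simp only [dC, pow_zero, mul_one, cC_succ, cC_zero]
    have a1 : 0 < Real.Gamma ((1 + α) * ((0:ℕ):ℝ) + 2) := Real.Gamma_pos_of_pos (by simp)
    have a2 : 0 < Real.Gamma ((1 + α) * ((0:ℕ):ℝ) + 2 + α) :=
      Real.Gamma_pos_of_pos (by simp; linarith)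
    have a3 := div_pos a1 a2
    have a4 : -1 / (1 + α) < 0 := div_neg_of_neg_of_pos (by norm_num) hp
    have : 0 < (1 + α) * ((0:ℕ):ℝ) + (1 + α) := by simp; exact hp
    rw [one_mul]
    exact mul_neg_of_pos_of_neg this (mul_neg_of_neg_of_pos a4 a3)
  obtain ⟨δ, hδ, hnear⟩ : ∃ δ > 0, ∀ x, 0 < x → x < δ → v x < 0 := by
    have := hQc.continuousAt.eventually (gt_mem_nhds hQ0)
    obtain ⟨δ, hδ, h⟩ := Metric.eventually_nhds_iff.1 this
    refine ⟨δ, hδ, fun x hx hxd => ?_⟩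
    have h2 := h (y := x) (by rw [Real.dist_eq, sub_zero, abs_of_pos hx]; exact hxd)
    exact mul_neg_of_pos_of_neg (Real.rpow_pos_of_pos hx _) h2
  by_contra hcon
  push Not at hcon
  set Z : Set ℝ := Ici δ ∩ {x | 0 ≤ v x} with hZ
  have hZc : IsClosed Z := isClosed_Ici.inter (isClosed_le continuous_const hvc)
  have hZne : Z.Nonempty := ⟨x, by
    by_contra hlt
    exact absurd (hnear x hx (by
      by_contra hge; exact hlt ⟨not_lt.1 hge, hcon⟩)) (not_lt.2 hcon)⟩
  have hZb : BddBelow Z := ⟨δ, fun y hy => hy.1⟩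
  set X := sInf Z with hXdef
  have hXZ : X ∈ Z := hZc.csInf_mem hZne hZb
  have hX : 0 < X := lt_of_lt_of_le hδ hXZ.1
  have hbefore : ∀ y, 0 < y → y < X → v y < 0 := by
    intro y hy hyX
    by_contra hge
    rcases lt_or_ge y δ with h | h
    · exact hge (hnear y hy h)
    · exact absurd (csInf_le hZb (⟨h, not_lt.1 hge⟩ : y ∈ Z)) (not_le.2 hyX)
  have hvX : v X = 0 := by
    apply le_antisymm _ hXZ.2
    have : Tendsto v (𝓝[<] X) (𝓝 (v X)) := (hvc.tendsto X).mono_left nhdsWithin_le_nhds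
    refine le_of_tendsto this ?_
    filter_upwards [Ioo_mem_nhdsLT hX] with y hy
    exact (hbefore y hy.1 hy.2).le
  have hle : ∀ y ∈ Icc 0 X, v y ≤ 0 := by
    intro y hy
    rcases eq_or_lt_of_le hy.1 with h | h
    · rw [← h, hv0]
    rcases eq_or_lt_of_le hy.2 with h' | h'
    · rw [h', hvX]
    · exact (hbefore y h h').le
  have hii := SS_int (dC_SA h0 h1) hp hp h1 hX
  rw [show 1 + α - 1 = α by ring] at hii
  have hPhi : 0 < Phi α X := by
    have c1 := caputo1 h0 h1 hX
    have : 0 < ∫ τ in (0:ℝ)..X, - (SS (1 + α) α (dC α) τ * (X - τ) ^ (-α)) := by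
      apply intervalIntegral.intervalIntegral_pos_of_pos_on hii.neg _ hX
      intro τ hτ
      have a1 := hbefore τ hτ.1 hτ.2
      have a2 : 0 < (X - τ) ^ (-α) := Real.rpow_pos_of_pos (by linarith [hτ.2]) _
      have := mul_neg_of_neg_of_pos a1 a2
      simp only [Pi.neg_apply]
      linarith
    rw [intervalIntegral.integral_neg, c1] at this
    have h3 : 0 < (Real.Gamma (1 - α) / (1 + α) * X) * Phi α X := by linarith
    exact pos_of_mul_pos_right h3 (by positivity)
  have hi2 := SS_int ((dC_SA h0 h1).lin (1 + α) α) hp h0 h1 hX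
  have c2 := caputo2 h0 h1 hX
  have mp := maxprinc h0 h1 hX (u := fun x => - v x)
    (u' := fun x => - SS (1 + α) (α - 1) (fun n => ((1 + α) * n + α) * dC α n) x)
    hvc.neg.continuousOn (fun x hx => (SS_hasDerivAt (dC_SA h0 h1) (1 + α) α hx).neg)
    (by simp [hv0]) (by simp [hvX]) (fun y hy => by have := hle y hy; linarith)
    (by simp only [neg_mul]; exact hi2.neg)
  simp only [neg_mul, intervalIntegral.integral_neg] at mp
  rw [c2, ← hv, hvX, mul_zero, add_zero] at mp
  have : 0 < Real.Gamma (1 - α) / (1 + α) * Phi α X := by positivity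
  linarith

lemma Phi_anti {α : ℝ} (h0 : 0 < α) (h1 : α < 1) : AntitoneOn (Phi α) (Ici 0) := by
  apply antitoneOn_of_deriv_nonpos (convex_Ici 0) (Phi_cont h0 h1).continuousOn
  · intro x hx
    rw [interior_Ici] at hx
    exact (Phi_deriv h0 h1 hx).differentiableAt.differentiableWithinAt
  · intro x hx
    rw [interior_Ici] at hx
    rw [(Phi_deriv h0 h1 hx).deriv]
    exact (Phi_deriv_neg h0 h1 hx).le

lemma Phi_nonneg {α : ℝ} (h0 : 0 < α) (h1 : α < 1) {x : ℝ} (hx : 0 ≤ x) : 0 ≤ Phi α x := by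
  rcases eq_or_lt_of_le hx with h | h
  · rw [← h, Phi_zero h0 h1]; norm_num
  have hG : 0 < Real.Gamma (1 - α) := Real.Gamma_pos_of_pos (by linarith)
  have c1 := caputo1 h0 h1 h
  have : 0 ≤ ∫ τ in (0:ℝ)..x, - (SS (1 + α) α (dC α) τ * (x - τ) ^ (-α)) := by
    apply intervalIntegral.integral_nonneg h.le
    intro τ hτ
    have a2 : 0 ≤ (x - τ) ^ (-α) := Real.rpow_nonneg (by linarith [hτ.2]) _
    rcases eq_or_lt_of_le hτ.1 with h' | h'
    · rw [← h', SS, Real.zero_rpow h0.ne']; simp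
    have := mul_nonpos_of_nonpos_of_nonneg (Phi_deriv_neg h0 h1 h').le a2
    linarith
  rw [intervalIntegral.integral_neg, c1] at this
  by_contra hneg
  push Not at hneg
  have : (Real.Gamma (1 - α) / (1 + α) * x) * Phi α x < 0 :=
    mul_neg_of_pos_of_neg (by positivity) hneg
  linarith

lemma C1_ge {α : ℝ} (h0 : 0 < α) (h1 : α < 1) : 1 ≤ C1 α := by
  have hbase : IntervalIntegrable (fun u : ℝ => (1 - u) ^ (α - 1)) volume (1/2) 1 := by
    have := (intervalIntegral.intervalIntegrable_rpow' (a := 1/2) (b := 0)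
      (by linarith : -1 < α - 1)).comp_sub_left 1
    convert this using 1 <;> norm_num
  have hval : ∫ u in (1/2:ℝ)..1, (1 - u) ^ (α - 1) = (1/2) ^ α / α := by
    rw [intervalIntegral.integral_comp_sub_left (fun u => u ^ (α - 1)) 1,
      integral_rpow (Or.inl (by linarith))]
    norm_num
    rw [Real.zero_rpow h0.ne']; ring
  have hle : (1/2) ^ α / α ≤ ∫ u in (1/2:ℝ)..1, u ^ (-(1+α)) * (1-u) ^ (α-1) := by
    rw [← hval]
    refine intervalIntegral.integral_mono_on (by norm_num) hbase ?_ ?_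
    · refine hbase.continuousOn_mul ?_
      refine continuousOn_id.rpow_const fun u hu => Or.inl ?_
      rw [uIcc_of_le (by norm_num)] at hu
      have : (1/2:ℝ) ≤ u := hu.1
      simp only [id]; linarith
    · intro u hu
      have a1 : 0 ≤ (1 - u) ^ (α - 1) := Real.rpow_nonneg (by linarith [hu.2]) _
      have a2 : 1 ≤ u ^ (-(1 + α)) :=
        Real.one_le_rpow_of_pos_of_le_one_of_nonpos (by linarith [hu.1]) hu.2 (by linarith)
      nlinarith
  rw [C1]
  have h2 : (1/2) ^ α / α ≤ max (∫ u in (1/2:ℝ)..1, u ^ (-(1+α)) * (1-u) ^ (α-1)) 2 :=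
    hle.trans (le_max_left _ _)
  have h3 : α * (2:ℝ) ^ (1 + α) * ((1/2) ^ α / α) = 2 := by
    rw [Real.rpow_add (by norm_num), Real.rpow_one, one_div, Real.inv_rpow (by norm_num)]
    have : (0:ℝ) < 2 ^ α := by positivity
    field_simp
  have h4 : α * (2:ℝ) ^ (1 + α) * ((1/2) ^ α / α) ≤ _ :=
    mul_le_mul_of_nonneg_left h2 (by positivity : 0 ≤ α * (2:ℝ) ^ (1 + α))
  linarith

/-- `L¹` modulus of continuity of an even radially decreasing function. -/
lemma shift_L1 {E : ℝ → ℝ} {M y : ℝ} (hi : Integrable E)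
    (hmono : ∀ a b : ℝ, |a| ≤ |b| → E b ≤ E a) (hM : ∀ x, E x ≤ M) (hy : 0 < y) :
    ∫⁻ x, ‖E (x + y) - E x‖ₑ ≤ ENNReal.ofReal (2 * M * y) := by
  have hi' : Integrable (fun x => E (x + y)) := hi.comp_add_right y
  have hd : Integrable (fun x => E (x + y) - E x) := hi'.sub hi
  rw [← ofReal_integral_norm_eq_lintegral_enorm hd]
  apply ENNReal.ofReal_le_ofReal
  have hemb := measurableEmbedding_addRight y
  have hmp := measurePreserving_add_right (volume : Measure ℝ) y
  have hbd : ∫ x in (-(y/2))..(-(y/2) + y), E x ≤ M * y := by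
    have := intervalIntegral.integral_mono_on (μ := volume) (a := -(y/2)) (b := -(y/2) + y)
      (by linarith) hi.intervalIntegrable (intervalIntegrable_const (c := M)) (fun x _ => hM x)
    rw [intervalIntegral.integral_const, smul_eq_mul] at this
    nlinarith
  have s1 : ∫ x in Ioi (-(y/2)), ‖E (x + y) - E x‖ ≤ M * y := by
    have e : ∫ x in Ioi (-(y/2)), ‖E (x + y) - E x‖ = ∫ x in Ioi (-(y/2)), (E x - E (x + y)) := by
      refine setIntegral_congr_fun measurableSet_Ioi fun x hx => ?_
      have hx' : -(y/2) < x := hx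
      have : E (x + y) ≤ E x := hmono _ _ (by
        rw [abs_of_pos (by linarith : 0 < x + y)]; exact abs_le.2 ⟨by linarith, by linarith⟩)
      rw [Real.norm_eq_abs, abs_sub_comm, abs_of_nonneg (by linarith)]
    have e2 : ∫ x in Ioi (-(y/2)), E (x + y) = ∫ x in Ioi (-(y/2) + y), E x := by
      have := hmp.setIntegral_preimage_emb hemb E (Ioi (-(y/2) + y))
      rwa [preimage_add_const_Ioi, add_sub_cancel_right] at this
    rw [e, integral_sub hi.integrableOn hi'.integrableOn, e2,
      intervalIntegral.integral_Ioi_sub_Ioi hi.integrableOn (by linarith)]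
    exact hbd
  have s2 : ∫ x in Iic (-(y/2)), ‖E (x + y) - E x‖ ≤ M * y := by
    have e : ∫ x in Iic (-(y/2)), ‖E (x + y) - E x‖ = ∫ x in Iic (-(y/2)), (E (x + y) - E x) := by
      refine setIntegral_congr_fun measurableSet_Iic fun x hx => ?_
      have hx' : x ≤ -(y/2) := hx
      have : E x ≤ E (x + y) := hmono _ _ (by
        rw [abs_of_neg (by linarith : x < 0)]; exact abs_le.2 ⟨by linarith, by linarith⟩)
      rw [Real.norm_eq_abs, abs_of_nonneg (by linarith)]
    have e2 : ∫ x in Iic (-(y/2)), E (x + y) = ∫ x in Iic (-(y/2) + y), E x := by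
      have := hmp.setIntegral_preimage_emb hemb E (Iic (-(y/2) + y))
      rwa [preimage_add_const_Iic, add_sub_cancel_right] at this
    rw [e, integral_sub hi'.integrableOn hi.integrableOn, e2,
      intervalIntegral.integral_Iic_sub_Iic hi.integrableOn hi.integrableOn]
    exact hbd
  have := intervalIntegral.integral_Iic_add_Ioi (b := -(y/2)) (μ := volume)
    (f := fun x => ‖E (x + y) - E x‖) hd.norm.integrableOn hd.norm.integrableOn
  linarith

lemma weak_of_L1 {k : ℝ → ℝ → ℝ} (hk : Continuous (Function.uncurry k)) {g : ℝ → ℝ} {A : ℝ}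
    (hA : 0 ≤ A)
    (hg : IntegrableOn g (Ioi 0)) (hyg : IntegrableOn (fun y => y * g y) (Ioi 0))
    (hb : ∀ y, 0 < y → ∫⁻ x, ‖k x y‖ₑ ≤ ENNReal.ofReal (A * y)) (σ : ℝ) :
    ENNReal.ofReal σ * volume {x ∈ Ioi (0:ℝ) | σ < |∫ y in Ioi (0:ℝ), k x y * g y|}
      ≤ ENNReal.ofReal (A * ∫ y in Ioi (0:ℝ), |y * g y|) := by
  set H : ℝ → ENNReal := fun x => ∫⁻ y in Ioi (0:ℝ), ‖k x y‖ₑ * ‖g y‖ₑ with hH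
  have hm : AEMeasurable (Function.uncurry fun x y => ‖k x y‖ₑ * ‖g y‖ₑ)
      ((volume : Measure ℝ).prod (volume.restrict (Ioi (0:ℝ)))) := by
    have m1 : AEMeasurable (fun z : ℝ × ℝ => ‖k z.1 z.2‖ₑ)
        ((volume : Measure ℝ).prod (volume.restrict (Ioi (0:ℝ)))) :=
      hk.measurable.enorm.aemeasurable
    have m2 : AEMeasurable (fun z : ℝ × ℝ => ‖g z.2‖ₑ)
        ((volume : Measure ℝ).prod (volume.restrict (Ioi (0:ℝ)))) :=
      (hg.aestronglyMeasurable.enorm).comp_snd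
    exact m1.mul m2
  have hHm : AEMeasurable H volume := hm.lintegral_prod_right'
  calc ENNReal.ofReal σ * volume {x ∈ Ioi (0:ℝ) | σ < |∫ y in Ioi (0:ℝ), k x y * g y|}
      ≤ ENNReal.ofReal σ * volume {x | ENNReal.ofReal σ ≤ H x} := by
        refine mul_le_mul_right (measure_mono fun x hx => ?_) _
        have h1 : ENNReal.ofReal σ ≤ ‖∫ y in Ioi (0:ℝ), k x y * g y‖ₑ := by
          rw [Real.enorm_eq_ofReal_abs]
          exact ENNReal.ofReal_le_ofReal hx.2.le
        refine h1.trans ((enorm_integral_le_lintegral_enorm _).trans ?_)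
        simp only [enorm_mul]
        exact le_rfl
    _ ≤ ∫⁻ x, H x := mul_meas_ge_le_lintegral₀ hHm _
    _ = ∫⁻ y in Ioi (0:ℝ), ∫⁻ x, ‖k x y‖ₑ * ‖g y‖ₑ := lintegral_lintegral_swap hm
    _ ≤ ∫⁻ y in Ioi (0:ℝ), ENNReal.ofReal (A * |y * g y|) := by
        refine setLIntegral_mono' measurableSet_Ioi fun y hy => ?_
        have hy' : 0 < y := hy
        rw [lintegral_mul_const' _ _ enorm_ne_top]
        refine (mul_le_mul_left (hb y hy') _).trans_eq ?_
        rw [Real.enorm_eq_ofReal_abs, ← ENNReal.ofReal_mul (by positivity), abs_mul,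
          abs_of_pos hy', mul_assoc]
    _ = ENNReal.ofReal (A * ∫ y in Ioi (0:ℝ), |y * g y|) := by
        rw [← integral_const_mul, ofReal_integral_eq_lintegral_ofReal (hyg.abs.const_mul A)
          (Eventually.of_forall fun y => by positivity)]

theorem stmt12 (α : ℝ) (hα : α ∈ Set.Ioo (0:ℝ) 1) (g : ℝ → ℝ)
    (hg : IntegrableOn g (Set.Ioi 0))
    (hyg : IntegrableOn (fun y => y * g y) (Set.Ioi 0))
    (hsupp : HasCompactSupport g)
    (t : ℝ) (ht : 1 < t) (σ : ℝ) (hσ : 0 < σ) :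
    ENNReal.ofReal σ *
        volume {x ∈ Set.Ioi (0:ℝ) |
          σ < |(∫ y in Set.Ioi (0:ℝ), fundSol α t (x + y) * g y) -
                (∫ y in Set.Ioi (0:ℝ), g y) * fundSol α t x|} ≤
        ENNReal.ofReal (C2 α * t ^ (-1/(1+α)) * ∫ y in Set.Ioi (0:ℝ), |y * g y|) ∧
      ENNReal.ofReal σ *
        volume {x ∈ Set.Ioi (0:ℝ) |
          σ < |(∫ y in Set.Ioi (0:ℝ), fundSol α t (x - y) * g y) -
                (∫ y in Set.Ioi (0:ℝ), g y) * fundSol α t x|} ≤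
        ENNReal.ofReal (C2 α * t ^ (-1/(1+α)) * ∫ y in Set.Ioi (0:ℝ), |y * g y|) := by
  obtain ⟨h0, h1⟩ := hα
  by_cases ha : a0 α = 0
  · simp [fundSol, ha, not_lt.2 hσ.le]
  have hI : 2 * ∫ x in Set.Ioi (0:ℝ), Phi α x ≠ 0 := fun h => ha (by rw [a0, h, inv_zero])
  have hPhiInt : Integrable fun x : ℝ => Phi α |x| := by
    by_contra h
    exact hI (by rw [← integral_comp_abs, integral_undef h])
  have ha0 : 0 < a0 α := by
    refine lt_of_le_of_ne ?_ (Ne.symm ha)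
    rw [a0]
    have : 0 ≤ ∫ x in Set.Ioi (0:ℝ), Phi α x :=
      setIntegral_nonneg measurableSet_Ioi fun x hx => Phi_nonneg h0 h1 (le_of_lt hx)
    positivity
  set s : ℝ := t ^ (-1/(1+α)) with hs
  have hs0 : 0 < s := Real.rpow_pos_of_pos (by linarith) _
  set E : ℝ → ℝ := fundSol α t with hE
  have hEx : ∀ x, E x = a0 α * s * Phi α (|x| * s) := fun x => rfl
  have hEi : Integrable E := by
    have := (hPhiInt.comp_mul_right' hs0.ne').const_mul (a0 α * s)
    refine this.congr (Eventually.of_forall fun x => ?_)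
    simp only [hEx]
    rw [abs_mul, abs_of_pos hs0]
  have hEc : Continuous E := by
    have : Continuous fun x : ℝ => a0 α * s * Phi α (|x| * s) :=
      continuous_const.mul ((Phi_cont h0 h1).comp (by fun_prop))
    exact this
  have hmono : ∀ a b : ℝ, |a| ≤ |b| → E b ≤ E a := by
    intro a b hab
    rw [hEx, hEx]
    refine mul_le_mul_of_nonneg_left ?_ (by positivity)
    refine Phi_anti h0 h1 (by simp; positivity) (by simp; positivity) ?_
    gcongr
  have hEM : ∀ x, E x ≤ a0 α * s := by
    intro x
    have := hmono 0 x (by simp)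
    rwa [hEx 0, abs_zero, zero_mul, Phi_zero h0 h1, mul_one] at this
  have hE0 : ∀ x, 0 ≤ E x := fun x => by
    rw [hEx]; have := Phi_nonneg h0 h1 (by positivity : 0 ≤ |x| * s); positivity
  have heven : ∀ x, E (-x) = E x := fun x => by rw [hEx, hEx, abs_neg]
  have hbd : ∀ c : ℝ → ℝ, Continuous c → IntegrableOn (fun y => E (c y) * g y) (Ioi 0) := by
    intro c hc
    refine Integrable.bdd_mul (c := a0 α * s) hg (hEc.comp hc).aestronglyMeasurable
      (Eventually.of_forall fun y => ?_)
    rw [Real.norm_eq_abs, abs_of_nonneg (hE0 _)]; exact hEM _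
  have hsplit : ∀ (c : ℝ → ℝ), Continuous c → ∀ x,
      (∫ y in Ioi (0:ℝ), E (c y) * g y) - (∫ y in Ioi (0:ℝ), g y) * E x
        = ∫ y in Ioi (0:ℝ), (E (c y) - E x) * g y := by
    intro c hc x
    rw [mul_comm, ← integral_const_mul, ← integral_sub (hbd c hc) (hg.const_mul _)]
    congr 1; ext y; ring
  have hC : ENNReal.ofReal ((2 * (a0 α * s)) * ∫ y in Set.Ioi (0:ℝ), |y * g y|)
      ≤ ENNReal.ofReal (C2 α * s * ∫ y in Set.Ioi (0:ℝ), |y * g y|) := by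
    apply ENNReal.ofReal_le_ofReal
    refine mul_le_mul_of_nonneg_right ?_ (integral_nonneg fun y => abs_nonneg _)
    rw [C2]
    have := C1_ge h0 h1
    have h2 : 0 < a0 α * s := by positivity
    nlinarith
  have hL : ∀ y, 0 < y → ∫⁻ x, ‖E (x + y) - E x‖ₑ ≤ ENNReal.ofReal (2 * (a0 α * s) * y) :=
    fun y hy => shift_L1 hEi hmono hEM hy
  constructor
  · refine le_trans (le_of_eq ?_) ((weak_of_L1 (k := fun x y => E (x + y) - E x) ?_
      (by positivity) hg hyg hL σ).trans hC)
    · congr 2; ext x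
      rw [mem_ofPred_eq, mem_ofPred_eq, hsplit (fun y => x + y) (by fun_prop) x]
    · exact (hEc.comp (by fun_prop)).sub (hEc.comp (by fun_prop))
  · refine le_trans (le_of_eq ?_) ((weak_of_L1 (k := fun x y => E (x - y) - E x) ?_
      (by positivity) hg hyg ?_ σ).trans hC)
    · congr 2; ext x
      rw [mem_ofPred_eq, mem_ofPred_eq, hsplit (fun y => x - y) (by fun_prop) x]
    · exact (hEc.comp (by fun_prop)).sub (hEc.comp (by fun_prop))
    · intro y hy
      refine le_trans (le_of_eq ?_) (hL y hy)
      rw [← lintegral_neg_eq_self]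
      congr 1; ext x
      rw [← heven (-x - y), ← heven (-x)]
      congr 3 <;> ring
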